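/- For all real x ≥ 0, one has |tanh(x)/x - 1| ≤ x²/3 (with the convention tanh(0)/0 = 1), i.e. the Fourier multiplier symbol F₁(ξ) = tanh(√μ|ξ|)/(√μ|ξ|) satisfies |F₁(ξ) - 1| ≤ μ|ξ|²/3 for all μ ≥ 0 and ξ. -/

import Mathlib

theorem nonneg_of_hasDerivAt_nonneg {f f' : ℝ → ℝ} (hf : ∀ x, HasDerivAt f (f' x) x)
    (h0 : f 0 = 0) (hf' : ∀ x, 0 ≤ x → 0 ≤ f' x) {x : ℝ} (hx : 0 ≤ x) : 0 ≤ f x := by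
  have hmono : MonotoneOn f (Set.Ici 0) := by
    refine monotoneOn_of_deriv_nonneg (convex_Ici 0)
      (fun y _ => (hf y).continuousAt.continuousWithinAt)
      (fun y _ => (hf y).differentiableAt.differentiableWithinAt) fun y hy => ?_
    rw [(hf y).deriv]
    exact hf' y (interior_subset hy)
  simpa [h0] using hmono (Set.self_mem_Ici) hx hx

theorem Real.sinh_le_mul_cosh {x : ℝ} (hx : 0 ≤ x) : Real.sinh x ≤ x * Real.cosh x := by
  refine sub_nonneg.mp (nonneg_of_hasDerivAt_nonneg (f := fun y => y * Real.cosh y - Real.sinh y)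
    (f' := fun y => y * Real.sinh y) (fun y => ?_) (by simp) (fun y hy => ?_) hx)
  · refine (((hasDerivAt_id y).mul (Real.hasDerivAt_cosh y)).sub
      (Real.hasDerivAt_sinh y)).congr_deriv ?_
    simp
  · exact mul_nonneg hy (Real.sinh_nonneg_iff.mpr hy)

theorem Real.sub_cube_mul_cosh_le_sinh {x : ℝ} (hx : 0 ≤ x) :
    (x - x ^ 3 / 3) * Real.cosh x ≤ Real.sinh x := by
  refine sub_nonneg.mp (nonneg_of_hasDerivAt_nonneg
    (f := fun y => Real.sinh y - (y - y ^ 3 / 3) * Real.cosh y)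
    (f' := fun y => y * (y * Real.cosh y - Real.sinh y) + y ^ 3 / 3 * Real.sinh y)
    (fun y => ?_) (by simp) (fun y hy => ?_) hx)
  · refine ((Real.hasDerivAt_sinh y).sub (((hasDerivAt_id y).sub
      ((hasDerivAt_pow 3 y).div_const 3)).mul (Real.hasDerivAt_cosh y))).congr_deriv ?_
    simp
    ring
  · have h1 := sub_nonneg.mpr (Real.sinh_le_mul_cosh hy)
    have h2 := Real.sinh_nonneg_iff.mpr hy
    positivity

theorem Real.abs_tanh_div_sub_one_le {x : ℝ} (hx : 0 ≤ x) :
    |(if x = 0 then (1 : ℝ) else Real.tanh x / x) - 1| ≤ x ^ 2 / 3 := by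
  split_ifs with h
  · simp [h]
  have hpos : 0 < x := lt_of_le_of_ne hx (Ne.symm h)
  have hc := Real.cosh_pos x
  have hup : Real.tanh x / x ≤ 1 := by
    rw [div_le_one hpos, Real.tanh_eq_sinh_div_cosh, div_le_iff₀ hc]
    exact Real.sinh_le_mul_cosh hx
  have hlow : 1 - x ^ 2 / 3 ≤ Real.tanh x / x := by
    rw [le_div_iff₀ hpos, Real.tanh_eq_sinh_div_cosh, le_div_iff₀ hc]
    linarith [Real.sub_cube_mul_cosh_le_sinh hx]
  rw [abs_le]
  constructor <;> nlinarith [sq_nonneg x]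

/-- For all real `x ≥ 0`, `|tanh x / x - 1| ≤ x²/3` (with convention
`tanh 0 / 0 = 1`); consequently the symbol `F₁(ξ) = tanh(√μ|ξ|)/(√μ|ξ|)` satisfies
`|F₁(ξ) - 1| ≤ μ|ξ|²/3` for all `μ ≥ 0` and `ξ`. -/
theorem stmt0 :
    (∀ x : ℝ, 0 ≤ x →
      |(if x = 0 then (1 : ℝ) else Real.tanh x / x) - 1| ≤ x ^ 2 / 3) ∧
    ∀ (d : ℕ) (μ : ℝ), 0 ≤ μ → ∀ ξ : EuclideanSpace ℝ (Fin d),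
      |(if Real.sqrt μ * ‖ξ‖ = 0 then (1 : ℝ)
          else Real.tanh (Real.sqrt μ * ‖ξ‖) / (Real.sqrt μ * ‖ξ‖)) - 1|
        ≤ μ * ‖ξ‖ ^ 2 / 3 := by
  refine ⟨fun x hx => Real.abs_tanh_div_sub_one_le hx, fun d μ hμ ξ => ?_⟩
  have h := Real.abs_tanh_div_sub_one_le (mul_nonneg (Real.sqrt_nonneg μ) (norm_nonneg ξ))
  rwa [mul_pow, Real.sq_sqrt hμ] at h
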